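/- arXiv:2410.20525 — 4 statements merged into one kernel-verified Lean document; each statement's English description precedes it below -/
import Mathlib

section
/- Let G be a directed polymatroidal network and let x ∈ ℝ^{V∪E} satisfy ∑_{v∈V} deg_v x_v = 0 and ∑_{v∈V} deg_v x_v² > 0. Then there exists c ∈ ℝ such that, writing y = x + c·𝟏 (adding c to every coordinate), y⁺ = (max{y_i, 0})_{i∈V∪E}, and y⁻ = (max{−y_i, 0})_{i∈V∪E}, one has vol({v ∈ V : y_v > 0}) ≤ vol(V)/2, vol({v ∈ V : y_v < 0}) ≤ vol(V)/2, and (1) min{R⁺(y⁺), R⁺(−y⁻)} ≤ 2·R⁺(x); (2) min{R⁻(y⁺), R⁻(−y⁻)} ≤ 2·R⁻(x); (3) min{R⁺(y⁺) + R⁻(y⁺), R⁺(−y⁻) + R⁻(−y⁻)} ≤ 2·(R⁺(x) + R⁻(x)). (Rayleigh quotients whose denominator is zero are interpreted as 0.) -/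
open MeasureTheory

/-- Lovász extension of the set function `f`, with ground set `D`,
evaluated at the (nonnegative) vector `x`. -/
noncomputable def lovOn {E : Type*} (f : Set E → ℝ) (D : Set E) (x : E → ℝ) : ℝ :=
  ∫ θ in Set.Ioi (0 : ℝ), f (D ∩ {e | θ ≤ x e})

/-- A directed polymatroidal network on vertex type `V` and edge type `E`. -/
structure PolyNet (V E : Type*) [Fintype V] [Fintype E] where
  tail : E → V
  head : E → V
  w : V → ℝ
  w_nonneg : ∀ v, 0 ≤ w v
  ρp : V → Set E → ℝ
  ρm : V → Set E → ℝ
  ρp_nonneg : ∀ v A, 0 ≤ ρp v A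
  ρm_nonneg : ∀ v A, 0 ≤ ρm v A
  ρp_empty : ∀ v, ρp v ∅ = 0
  ρm_empty : ∀ v, ρm v ∅ = 0
  ρp_mono : ∀ v A B, A ⊆ B → B ⊆ {e | tail e = v} → ρp v A ≤ ρp v B
  ρm_mono : ∀ v A B, A ⊆ B → B ⊆ {e | head e = v} → ρm v A ≤ ρm v B
  ρp_submod : ∀ v A B, A ⊆ {e | tail e = v} → B ⊆ {e | tail e = v} →
    ρp v (A ∪ B) + ρp v (A ∩ B) ≤ ρp v A + ρp v B
  ρm_submod : ∀ v A B, A ⊆ {e | head e = v} → B ⊆ {e | head e = v} →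
    ρm v (A ∪ B) + ρm v (A ∩ B) ≤ ρm v A + ρm v B

namespace PolyNet

variable {V E : Type*} [Fintype V] [Fintype E] (N : PolyNet V E)

/-- The set of edges leaving `v`. -/
def outE (v : V) : Set E := {e | N.tail e = v}

/-- The set of edges entering `v`. -/
def inE (v : V) : Set E := {e | N.head e = v}

/-- The degree of a vertex. -/
noncomputable def deg (v : V) : ℝ := N.ρp v (N.outE v) + N.ρm v (N.inE v)

/-- The volume of a set of vertices. -/
noncomputable def vol (S : Set V) : ℝ := ∑ v, S.indicator N.deg v

/-- The total weight of a set of vertices. -/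
noncomputable def wsum (S : Set V) : ℝ := ∑ v, S.indicator N.w v

/-- An assignment `g` of (cut) edges to vertices is valid on `F` if every edge of `F` is
assigned to one of its endpoints. -/
def valid (F : Set E) (g : E → V) : Prop := ∀ e ∈ F, g e = N.tail e ∨ g e = N.head e

/-- The cost of the cut `F` under the assignment `g`. -/
noncomputable def cutCost (F : Set E) (g : E → V) : ℝ :=
  ∑ v, (N.ρp v (N.outE v ∩ F ∩ {e | g e = v}) + N.ρm v (N.inE v ∩ F ∩ {e | g e = v}))

/-- The cost of the cut `F`: minimum over valid assignments. -/
noncomputable def cut (F : Set E) : ℝ :=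
  sInf {c | ∃ g : E → V, N.valid F g ∧ c = N.cutCost F g}

/-- Edges from `S` to its complement. -/
def dplus (S : Set V) : Set E := {e | N.tail e ∈ S ∧ N.head e ∉ S}

/-- Edges from the complement of `S` into `S`. -/
def dminus (S : Set V) : Set E := {e | N.tail e ∉ S ∧ N.head e ∈ S}

/-- The (directed) value of the cut induced by `S`. -/
noncomputable def cutval (S : Set V) : ℝ := min (N.cut (N.dplus S)) (N.cut (N.dminus S))

/-- The symmetric value of the cut induced by `S`. -/
noncomputable def symcutval (S : Set V) : ℝ := N.cut (N.dplus S) + N.cut (N.dminus S)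

/-- The Rayleigh quotient `R⁺`. -/
noncomputable def Rp (x : V ⊕ E → ℝ) : ℝ :=
  (∑ v, (lovOn (N.ρp v) (N.outE v) (fun e => (max 0 (x (Sum.inl v) - x (Sum.inr e)))^2)
       + lovOn (N.ρm v) (N.inE v) (fun e => (max 0 (x (Sum.inr e) - x (Sum.inl v)))^2)))
  / ∑ v, N.deg v * (x (Sum.inl v))^2

/-- The Rayleigh quotient `R⁻`. -/
noncomputable def Rm (x : V ⊕ E → ℝ) : ℝ :=
  (∑ v, (lovOn (N.ρp v) (N.outE v) (fun e => (max 0 (x (Sum.inr e) - x (Sum.inl v)))^2)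
       + lovOn (N.ρm v) (N.inE v) (fun e => (max 0 (x (Sum.inl v) - x (Sum.inr e)))^2)))
  / ∑ v, N.deg v * (x (Sum.inl v))^2

/-- The Rayleigh quotient `R`. -/
noncomputable def Ray (x : V ⊕ E → ℝ) : ℝ := min (N.Rp x) (N.Rm x)

/-- The symmetric Rayleigh quotient `R̄`. -/
noncomputable def RaySym (x : V ⊕ E → ℝ) : ℝ := N.Rp x + N.Rm x

/-- The spectral gap `γ₂` of a polymatroidal network. -/
noncomputable def gap : ℝ :=
  sInf {r | ∃ x : V ⊕ E → ℝ, (∑ v, N.deg v * x (Sum.inl v)) = 0 ∧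
    (0 < ∑ v, N.deg v * (x (Sum.inl v))^2) ∧ r = N.Ray x}

end PolyNet

/-- The level-set integrand of the Lovász extension of a monotone normalized set function is
integrable. -/
lemma integrableOn_lovOn {E : Type*} [Finite E] {f : Set E → ℝ} {D : Set E} (h0 : f ∅ = 0)
    (hm : ∀ A B, A ⊆ B → B ⊆ D → f A ≤ f B) (x : E → ℝ) :
    IntegrableOn (fun θ : ℝ => f (D ∩ {e | θ ≤ x e})) (Set.Ioi 0) := by
  have hanti : Antitone fun θ : ℝ => f (D ∩ {e | θ ≤ x e}) := fun a b hab =>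
    hm _ _ (Set.inter_subset_inter_right _ fun e he => le_trans hab he) Set.inter_subset_left
  obtain ⟨M, hM⟩ := (Set.finite_range x).bddAbove
  have hcov : Set.Ioi (0 : ℝ) ⊆ Set.Icc 0 M ∪ Set.Ioi M := fun θ hθ => by
    rcases le_or_gt θ M with h | h
    · exact Or.inl ⟨le_of_lt hθ, h⟩
    · exact Or.inr h
  refine IntegrableOn.mono_set (IntegrableOn.union ?_ ?_) hcov
  · exact (hanti.antitoneOn _).integrableOn_isCompact isCompact_Icc
  · refine integrableOn_zero.congr_fun (fun θ hθ => ?_) measurableSet_Ioi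
    have hempty : D ∩ {e | θ ≤ x e} = ∅ := by
      ext e
      have hlt : x e < θ := (hM ⟨e, rfl⟩).trans_lt hθ
      simp [hlt]
    simp only [hempty, h0]

/-- The Lovász extension of a nonnegative monotone normalized set function is monotone. -/
lemma lovOn_mono {E : Type*} [Finite E] {f : Set E → ℝ} {D : Set E} (hn : ∀ A, 0 ≤ f A)
    (h0 : f ∅ = 0) (hm : ∀ A B, A ⊆ B → B ⊆ D → f A ≤ f B) {x y : E → ℝ} (hxy : x ≤ y) :
    lovOn f D x ≤ lovOn f D y :=
  integral_mono_of_nonneg (.of_forall fun _ => hn _) (integrableOn_lovOn h0 hm y)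
    (.of_forall fun _ => hm _ _
      (Set.inter_subset_inter_right _ fun e he => le_trans he (hxy e)) Set.inter_subset_left)

lemma lovOn_nonneg {E : Type*} {f : Set E → ℝ} {D : Set E} (hn : ∀ A, 0 ≤ f A) (x : E → ℝ) :
    0 ≤ lovOn f D x :=
  integral_nonneg fun _ => hn _

/-- If two numerators are at most `n` and the denominators sum to at least `d`, the smaller
quotient is at most `2 * (n / d)`. -/
lemma min_div_le_two_mul_div {a b n d₁ d₂ d : ℝ} (ha : a ≤ n) (hb : b ≤ n) (hn : 0 ≤ n)
    (hd : 0 < d) (hsum : d ≤ d₁ + d₂) : min (a / d₁) (b / d₂) ≤ 2 * (n / d) := by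
  have key : ∀ t s : ℝ, t ≤ n → d / 2 ≤ s → t / s ≤ 2 * (n / d) := fun t s ht hs =>
    calc t / s ≤ n / (d / 2) := div_le_div₀ hn ht (by positivity) hs
      _ = 2 * (n / d) := by field_simp
  rcases le_or_gt (d / 2) d₁ with h | h
  · exact (min_le_left _ _).trans (key _ _ ha h)
  · exact (min_le_right _ _).trans (key _ _ hb (by linarith))

namespace PolyNet

variable {V E : Type*} [Fintype V] [Fintype E] (N : PolyNet V E)

/-- The numerator of the Rayleigh quotient `R⁺`. -/
noncomputable def energyPlus (x : V ⊕ E → ℝ) : ℝ :=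
  ∑ v, (lovOn (N.ρp v) (N.outE v) (fun e => (max 0 (x (Sum.inl v) - x (Sum.inr e)))^2)
       + lovOn (N.ρm v) (N.inE v) (fun e => (max 0 (x (Sum.inr e) - x (Sum.inl v)))^2))

/-- The numerator of the Rayleigh quotient `R⁻`. -/
noncomputable def energyMinus (x : V ⊕ E → ℝ) : ℝ :=
  ∑ v, (lovOn (N.ρp v) (N.outE v) (fun e => (max 0 (x (Sum.inr e) - x (Sum.inl v)))^2)
       + lovOn (N.ρm v) (N.inE v) (fun e => (max 0 (x (Sum.inl v) - x (Sum.inr e)))^2))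

/-- The common denominator of the Rayleigh quotients. -/
noncomputable def sqMass (x : V ⊕ E → ℝ) : ℝ := ∑ v, N.deg v * (x (Sum.inl v))^2

lemma Rp_eq (x : V ⊕ E → ℝ) : N.Rp x = N.energyPlus x / N.sqMass x := rfl

lemma Rm_eq (x : V ⊕ E → ℝ) : N.Rm x = N.energyMinus x / N.sqMass x := rfl

lemma energyPlus_nonneg (x : V ⊕ E → ℝ) : 0 ≤ N.energyPlus x :=
  Finset.sum_nonneg fun v _ =>
    add_nonneg (lovOn_nonneg (N.ρp_nonneg v) _) (lovOn_nonneg (N.ρm_nonneg v) _)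

lemma energyMinus_nonneg (x : V ⊕ E → ℝ) : 0 ≤ N.energyMinus x :=
  Finset.sum_nonneg fun v _ =>
    add_nonneg (lovOn_nonneg (N.ρp_nonneg v) _) (lovOn_nonneg (N.ρm_nonneg v) _)

/-- Applying a monotone `1`-Lipschitz function to every coordinate does not increase the
numerator of `R⁺`. -/
lemma energyPlus_comp_le {φ : ℝ → ℝ} (hφ : ∀ a b, max 0 (φ a - φ b) ≤ max 0 (a - b))
    (x : V ⊕ E → ℝ) : N.energyPlus (fun i => φ (x i)) ≤ N.energyPlus x :=
  Finset.sum_le_sum fun v _ => add_le_add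
    (lovOn_mono (N.ρp_nonneg v) (N.ρp_empty v) (N.ρp_mono v) fun _ =>
      pow_le_pow_left₀ (le_max_left _ _) (hφ _ _) 2)
    (lovOn_mono (N.ρm_nonneg v) (N.ρm_empty v) (N.ρm_mono v) fun _ =>
      pow_le_pow_left₀ (le_max_left _ _) (hφ _ _) 2)

/-- Applying a monotone `1`-Lipschitz function to every coordinate does not increase the
numerator of `R⁻`. -/
lemma energyMinus_comp_le {φ : ℝ → ℝ} (hφ : ∀ a b, max 0 (φ a - φ b) ≤ max 0 (a - b))
    (x : V ⊕ E → ℝ) : N.energyMinus (fun i => φ (x i)) ≤ N.energyMinus x :=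
  Finset.sum_le_sum fun v _ => add_le_add
    (lovOn_mono (N.ρp_nonneg v) (N.ρp_empty v) (N.ρp_mono v) fun _ =>
      pow_le_pow_left₀ (le_max_left _ _) (hφ _ _) 2)
    (lovOn_mono (N.ρm_nonneg v) (N.ρm_empty v) (N.ρm_mono v) fun _ =>
      pow_le_pow_left₀ (le_max_left _ _) (hφ _ _) 2)

lemma deg_nonneg (v : V) : 0 ≤ N.deg v :=
  add_nonneg (N.ρp_nonneg _ _) (N.ρm_nonneg _ _)

lemma vol_nonneg (S : Set V) : 0 ≤ N.vol S :=
  Finset.sum_nonneg fun _ _ => Set.indicator_nonneg (fun v _ => N.deg_nonneg v) _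

lemma vol_empty : N.vol ∅ = 0 := by simp [vol]

lemma vol_add_vol_le_of_disjoint {S T : Set V} (h : Disjoint S T) :
    N.vol S + N.vol T ≤ N.vol Set.univ := by
  rw [vol, vol, vol, ← Finset.sum_add_distrib]
  refine Finset.sum_le_sum fun v _ => ?_
  rw [← congrFun (Set.indicator_union_of_disjoint h N.deg) v]
  exact Set.indicator_le_indicator_of_subset (Set.subset_univ _) N.deg_nonneg v

/-- Every function on the vertices has a median with respect to the volume. -/
lemma exists_median [Nonempty V] (z : V → ℝ) :
    ∃ m : ℝ, N.vol {v | m < z v} ≤ N.vol Set.univ / 2 ∧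
      N.vol {v | z v < m} ≤ N.vol Set.univ / 2 := by
  have hV := N.vol_nonneg Set.univ
  obtain ⟨t, ht⟩ := Finite.exists_max z
  have htS : t ∈ {v | N.vol {u | z v < z u} ≤ N.vol Set.univ / 2} := by
    have hempty : {u | z t < z u} = ∅ := by
      ext u
      simp [ht u]
    rw [Set.mem_ofPred_eq, hempty, vol_empty]
    linarith
  obtain ⟨s, hs, hmin⟩ := Set.exists_min_image _ z (Set.toFinite _) ⟨t, htS⟩
  refine ⟨z s, hs, ?_⟩
  by_contra! hlt
  have hne : {v | z v < z s}.Nonempty := by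
    rw [Set.nonempty_iff_ne_empty]
    intro hempty
    rw [hempty, vol_empty] at hlt
    linarith
  obtain ⟨u, hu, hmax⟩ := Set.exists_max_image _ z (Set.toFinite _) hne
  have hbig : N.vol Set.univ / 2 < N.vol {v | z u < z v} := by
    by_contra! h
    exact absurd (hmin u h) (not_le.mpr hu)
  have hdisj : Disjoint {v | z u < z v} {v | z v < z s} :=
    Set.disjoint_left.mpr fun v h₁ h₂ => absurd (hmax v h₂) (not_le.mpr h₁)
  linarith [N.vol_add_vol_le_of_disjoint hdisj]

/-- For mean-zero `x`, the positive and negative parts of any shift of `x` have together at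
least the squared mass of `x`. -/
lemma sqMass_le_add_of_mean_zero {x : V ⊕ E → ℝ} (hmean : ∑ v, N.deg v * x (Sum.inl v) = 0)
    (c : ℝ) :
    N.sqMass x ≤ N.sqMass (fun i => max (x i + c) 0) +
      N.sqMass (fun i => -(max (-(x i + c)) 0)) := by
  have hsplit : ∀ t : ℝ, (max t 0)^2 + (-(max (-t) 0))^2 = t^2 := fun t => by
    rcases le_total t 0 with h | h
    · rw [max_eq_right h, max_eq_left (by linarith)]; ring
    · rw [max_eq_left h, max_eq_right (by linarith)]; ring
  have hshift : N.sqMass (fun i => max (x i + c) 0) +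
      N.sqMass (fun i => -(max (-(x i + c)) 0)) =
        N.sqMass x + 2 * c * (∑ v, N.deg v * x (Sum.inl v)) + ∑ v, N.deg v * c^2 := by
    simp only [sqMass, Finset.mul_sum, ← Finset.sum_add_distrib]
    refine Finset.sum_congr rfl fun v _ => ?_
    rw [← mul_add, hsplit]
    ring
  have hc : 0 ≤ ∑ v, N.deg v * c^2 :=
    Finset.sum_nonneg fun v _ => mul_nonneg (N.deg_nonneg v) (sq_nonneg c)
  rw [hshift, hmean]
  linarith

end PolyNet

/-- Shifting lemma: given `x` with `∑ deg_v x_v = 0` and `∑ deg_v x_v² > 0`,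
some shift `y = x + c·𝟏` has both `{y_v > 0}` and `{y_v < 0}` of volume at most
`vol(V)/2`, and the Rayleigh quotients of `y⁺` and `−y⁻` compare to those of `x`
as stated. -/
theorem rayleigh_shift {V E : Type*} [Fintype V] [Fintype E] (N : PolyNet V E)
    (x : V ⊕ E → ℝ) (hmean : (∑ v, N.deg v * x (Sum.inl v)) = 0)
    (hpos : 0 < ∑ v, N.deg v * (x (Sum.inl v))^2) :
    ∃ c : ℝ,
      N.vol {v | 0 < x (Sum.inl v) + c} ≤ N.vol Set.univ / 2 ∧
      N.vol {v | x (Sum.inl v) + c < 0} ≤ N.vol Set.univ / 2 ∧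
      min (N.Rp (fun i => max (x i + c) 0)) (N.Rp (fun i => -(max (-(x i + c)) 0)))
        ≤ 2 * N.Rp x ∧
      min (N.Rm (fun i => max (x i + c) 0)) (N.Rm (fun i => -(max (-(x i + c)) 0)))
        ≤ 2 * N.Rm x ∧
      min (N.Rp (fun i => max (x i + c) 0) + N.Rm (fun i => max (x i + c) 0))
          (N.Rp (fun i => -(max (-(x i + c)) 0)) + N.Rm (fun i => -(max (-(x i + c)) 0)))
        ≤ 2 * (N.Rp x + N.Rm x) := by
  have : Nonempty V := by
    by_contra h
    rw [not_nonempty_iff] at h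
    simp at hpos
  obtain ⟨m, hm₁, hm₂⟩ := N.exists_median fun v => x (Sum.inl v)
  have hp : ∀ a b : ℝ, max 0 (max (a + -m) 0 - max (b + -m) 0) ≤ max 0 (a - b) := by
    intro a b
    grind
  have hn : ∀ a b : ℝ, max 0 (-(max (-(a + -m)) 0) - -(max (-(b + -m)) 0)) ≤ max 0 (a - b) := by
    intro a b
    grind
  have hd := N.sqMass_le_add_of_mean_zero hmean (-m)
  have hpp := N.energyPlus_comp_le hp x
  have hpn := N.energyPlus_comp_le hn x
  have hmp := N.energyMinus_comp_le hp x
  have hmn := N.energyMinus_comp_le hn x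
  have hplus := N.energyPlus_nonneg x
  have hminus := N.energyMinus_nonneg x
  refine ⟨-m, ?_, ?_, ?_, ?_, ?_⟩
  · simpa only [← sub_eq_add_neg, sub_pos] using hm₁
  · simpa only [← sub_eq_add_neg, sub_neg] using hm₂
  · exact min_div_le_two_mul_div hpp hpn hplus hpos hd
  · exact min_div_le_two_mul_div hmp hmn hminus hpos hd
  · simp only [PolyNet.Rp_eq, PolyNet.Rm_eq, ← add_div]
    exact min_div_le_two_mul_div (add_le_add hpp hmp) (add_le_add hpn hmn)
      (add_nonneg hplus hminus) hpos hd
end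

section
/- There exists a universal constant C > 0 with the following property. For all positive integers n and d, all vectors a₁, …, a_d ∈ ℝⁿ, and every normalized monotone submodular function ρ : 2^{{1,…,d}} → ℝ≥0 with Lovász extension ρ̂, one has ∫_{ℝⁿ} ρ̂((⟨a₁, g⟩², …, ⟨a_d, g⟩²)) dγₙ(g) ≤ C·(1 + log d)·ρ̂((‖a₁‖², …, ‖a_d‖²)), where γₙ is the standard Gaussian measure on ℝⁿ (the n-fold product of the standard Gaussian on ℝ). -/
open MeasureTheory ProbabilityTheory

/-- The Lovász extension of a set function `f` on a finite ground set,
evaluated at a (nonnegative) vector `x`: `f̂(x) = ∫₀^∞ f({i : x i ≥ θ}) dθ`. -/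
noncomputable def lovasz {N : Type*} [Fintype N] (f : Set N → ℝ) (x : N → ℝ) : ℝ :=
  ∫ θ in Set.Ioi (0 : ℝ), f {i | θ ≤ x i}

/-- A linear form `∑ b_j g_j` in independent standard Gaussians with unit coefficient vector
is again a standard Gaussian. -/
lemma map_sum_mul_pi_gaussianReal {ι : Type*} [Fintype ι] (b : ι → ℝ) (hb : ∑ j, b j ^ 2 = 1) :
    (Measure.pi fun _ : ι => gaussianReal 0 1).map (fun g => ∑ j, b j * g j)
      = gaussianReal 0 1 := by
  have hm : Measurable fun g : ι → ℝ => ∑ j, b j * g j := by fun_prop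
  have : IsProbabilityMeasure
      ((Measure.pi fun _ : ι => gaussianReal 0 1).map fun g => ∑ j, b j * g j) :=
    Measure.isProbabilityMeasure_map hm.aemeasurable
  refine Measure.ext_of_charFun (funext fun t => ?_)
  rw [charFun_apply_real, integral_map hm.aemeasurable (by fun_prop)]
  have hprod : ∀ g : ι → ℝ, Complex.exp (t * (∑ j, b j * g j : ℝ) * Complex.I)
      = ∏ j, Complex.exp ((t * b j : ℝ) * (g j) * Complex.I) := by
    intro g
    rw [← Complex.exp_sum]
    congr 1
    push_cast
    rw [Finset.mul_sum, Finset.sum_mul]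
    exact Finset.sum_congr rfl fun j _ => by ring
  simp_rw [hprod]
  rw [integral_fintype_prod_eq_prod
    (fun j x => Complex.exp ((t * b j : ℝ) * (x : ℝ) * Complex.I))]
  simp_rw [← charFun_apply_real, charFun_gaussianReal]
  rw [← Complex.exp_sum]
  congr 1
  have hb' : ∑ j, (b j : ℂ) ^ 2 = 1 := by exact_mod_cast hb
  calc _ = ∑ j, -((t : ℂ) ^ 2 / 2) * (b j : ℂ) ^ 2 :=
        Finset.sum_congr rfl fun j _ => by push_cast; ring
    _ = _ := by rw [← Finset.mul_sum, hb']; push_cast; ring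

/-- `exp (x ^ 2 / 4)` against the standard Gaussian density. -/
lemma gaussianPDFReal_mul_exp_sq_div_four (x : ℝ) :
    gaussianPDFReal 0 1 x * Real.exp (x ^ 2 / 4)
      = (√(2 * Real.pi))⁻¹ * Real.exp (-(1 / 4) * x ^ 2) := by
  rw [gaussianPDFReal, mul_assoc, ← Real.exp_add]
  congr 2
  · simp
  · push_cast; ring

lemma integrable_exp_sq_div_four_gaussianReal :
    Integrable (fun x : ℝ => Real.exp (x ^ 2 / 4)) (gaussianReal 0 1) := by
  rw [gaussianReal_of_var_ne_zero _ one_ne_zero,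
    integrable_withDensity_iff_integrable_smul' (measurable_gaussianPDF _ _)
      (Filter.Eventually.of_forall fun _ => gaussianPDF_lt_top)]
  simp_rw [toReal_gaussianPDF, smul_eq_mul, gaussianPDFReal_mul_exp_sq_div_four]
  exact (integrable_exp_neg_mul_sq (by norm_num)).const_mul _

lemma integral_exp_sq_div_four_gaussianReal :
    ∫ x, Real.exp (x ^ 2 / 4) ∂(gaussianReal 0 1) = √2 := by
  rw [integral_gaussianReal_eq_integral_smul one_ne_zero]
  simp_rw [smul_eq_mul, gaussianPDFReal_mul_exp_sq_div_four]
  rw [integral_const_mul, integral_gaussian, ← Real.sqrt_inv,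
    ← Real.sqrt_mul (by positivity)]
  congr 1
  field_simp
  norm_num

section Lovasz

variable {N : Type*} [Fintype N] {ρ : Set N → ℝ}

lemma lovasz_nonneg (hnonneg : ∀ A, 0 ≤ ρ A) (x : N → ℝ) : 0 ≤ lovasz ρ x :=
  integral_nonneg fun _ => hnonneg _

lemma integrableOn_superlevel (hempty : ρ ∅ = 0) (hmono : ∀ A B, A ⊆ B → ρ A ≤ ρ B)
    (x : N → ℝ) : IntegrableOn (fun θ : ℝ => ρ {i | θ ≤ x i}) (Set.Ioi 0) := by
  have hanti : Antitone fun θ : ℝ => ρ {i | θ ≤ x i} := fun s t hst =>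
    hmono _ _ fun _ hi => hst.trans hi
  obtain ⟨M, hM⟩ := (Set.finite_range x).bddAbove
  have hcompact : IntegrableOn (fun θ : ℝ => ρ {i | θ ≤ x i}) (Set.Icc 0 M) :=
    (hanti.antitoneOn _).integrableOn_isCompact isCompact_Icc
  refine hcompact.of_forall_sdiff_eq_zero measurableSet_Ioi fun θ hθ => ?_
  have hlt : M < θ := by
    by_contra! h
    exact hθ.2 ⟨le_of_lt hθ.1, h⟩
  rw [← hempty]
  congr 1
  ext i
  simpa using (hM (Set.mem_range_self i)).trans_lt hlt

lemma lovasz_mono (hempty : ρ ∅ = 0) (hnonneg : ∀ A, 0 ≤ ρ A)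
    (hmono : ∀ A B, A ⊆ B → ρ A ≤ ρ B) {x y : N → ℝ} (hxy : x ≤ y) :
    lovasz ρ x ≤ lovasz ρ y :=
  integral_mono_of_nonneg (Filter.Eventually.of_forall fun _ => hnonneg _)
    (integrableOn_superlevel hempty hmono y)
    (Filter.Eventually.of_forall fun _ => hmono _ _ fun i hi => le_trans hi (hxy i))

lemma lovasz_smul (ρ : Set N → ℝ) (x : N → ℝ) {c : ℝ} (hc : 0 < c) :
    lovasz ρ (c • x) = c * lovasz ρ x := by
  have h := integral_comp_mul_left_Ioi' (fun θ : ℝ => ρ {i | θ ≤ (c • x) i}) 0 hc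
  simp only [Pi.smul_apply, smul_eq_mul, mul_zero, mul_le_mul_iff_right₀ hc] at h
  exact h.symm

end Lovasz

section GaussianForm

variable {ι : Type*} [Fintype ι]

/-- The linear form `⟨b, g⟩`, normalized by `‖b‖`. It vanishes for `b = 0`. -/
noncomputable def normalizedForm (b g : ι → ℝ) : ℝ := (∑ j, b j * g j) / √(∑ j, b j ^ 2)

lemma sq_sum_mul_eq (b g : ι → ℝ) :
    (∑ j, b j * g j) ^ 2 = normalizedForm b g ^ 2 * ∑ j, b j ^ 2 := by
  have hnn : 0 ≤ ∑ j, b j ^ 2 := Finset.sum_nonneg fun j _ => sq_nonneg _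
  rcases hnn.eq_or_lt with h | h
  · have hb : ∀ j, b j = 0 := fun j => by
      simpa using (Finset.sum_eq_zero_iff_of_nonneg fun j _ => sq_nonneg (b j)).1 h.symm j
        (Finset.mem_univ j)
    simp [hb]
  · rw [normalizedForm, div_pow, Real.sq_sqrt hnn, div_mul_cancel₀ _ h.ne']

lemma exp_sq_normalizedForm_integrable_and_le (b : ι → ℝ) :
    Integrable (fun g => Real.exp (normalizedForm b g ^ 2 / 4))
        (Measure.pi fun _ : ι => gaussianReal 0 1) ∧
      ∫ g, Real.exp (normalizedForm b g ^ 2 / 4)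
        ∂(Measure.pi fun _ : ι => gaussianReal 0 1) ≤ √2 := by
  have hnn : 0 ≤ ∑ j, b j ^ 2 := Finset.sum_nonneg fun j _ => sq_nonneg _
  rcases hnn.eq_or_lt with h | h
  · have h0 : ∀ g, normalizedForm b g = 0 := fun g => by simp [normalizedForm, ← h]
    simp only [h0]
    refine ⟨integrable_const _, ?_⟩
    simp
  · set c := √(∑ j, b j ^ 2) with hc
    have hform : ∀ g, normalizedForm b g = ∑ j, b j / c * g j := fun g => by
      rw [normalizedForm, ← hc, Finset.sum_div]
      exact Finset.sum_congr rfl fun j _ => by ring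
    have hunit : ∑ j, (b j / c) ^ 2 = 1 := by
      simp_rw [div_pow, hc, Real.sq_sqrt hnn, ← Finset.sum_div]
      exact div_self h.ne'
    have hlaw := map_sum_mul_pi_gaussianReal _ hunit
    have hm : Measurable fun g : ι → ℝ => ∑ j, b j / c * g j := by fun_prop
    simp_rw [hform]
    refine ⟨?_, ?_⟩
    · have hint := integrable_exp_sq_div_four_gaussianReal
      rw [← hlaw] at hint
      exact hint.comp_measurable hm
    · have hint := integral_exp_sq_div_four_gaussianReal
      rw [← hlaw, integral_map hm.aemeasurable (by fun_prop)] at hint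
      exact hint.le

end GaussianForm

/-- A maximum of `d` numbers is bounded by `log d` plus the average of their exponentials. -/
lemma le_log_add_average_exp {d : ℕ} (hd : 0 < d) (u : Fin d → ℝ) (i : Fin d) :
    u i ≤ Real.log d + (∑ k, Real.exp (u k)) / d := by
  have hd' : (0 : ℝ) < d := by exact_mod_cast hd
  have h1 := Real.add_one_le_exp (u i - Real.log d)
  rw [Real.exp_sub, Real.exp_log hd'] at h1
  have h2 : Real.exp (u i) / d ≤ (∑ k, Real.exp (u k)) / d := by
    gcongr
    exact Finset.single_le_sum (fun k _ => (Real.exp_pos (u k)).le) (Finset.mem_univ i)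
  linarith

/-- Gaussian projection bound for Lovász extensions: there is a universal
constant `C > 0` such that for all vectors `a₁, …, a_d ∈ ℝⁿ` and every
normalized monotone submodular `ρ` on `{1, …, d}`,
`𝔼_g[ρ̂(⟨a₁,g⟩², …, ⟨a_d,g⟩²)] ≤ C (1 + log d) ρ̂(‖a₁‖², …, ‖a_d‖²)`,
where `g` is a standard Gaussian vector in `ℝⁿ`. -/
theorem lovasz_gaussian_projection_bound :
    ∃ C : ℝ, 0 < C ∧ ∀ (n d : ℕ), 0 < n → 0 < d →
      ∀ (a : Fin d → Fin n → ℝ) (ρ : Set (Fin d) → ℝ),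
        ρ ∅ = 0 → (∀ A, 0 ≤ ρ A) → (∀ A B, A ⊆ B → ρ A ≤ ρ B) →
        (∀ A B, ρ (A ∪ B) + ρ (A ∩ B) ≤ ρ A + ρ B) →
        (∫ g : Fin n → ℝ, lovasz ρ (fun i => (∑ j, a i j * g j)^2)
            ∂(Measure.pi fun _ => gaussianReal 0 1))
          ≤ C * (1 + Real.log d) * lovasz ρ (fun i => ∑ j, (a i j)^2) := by
  refine ⟨8, by norm_num, fun n d _ hd a ρ hempty hnonneg hmono _ => ?_⟩
  have hd' : (0 : ℝ) < d := by exact_mod_cast hd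
  have hlog : 0 ≤ Real.log d := Real.log_natCast_nonneg d
  set μ : Measure (Fin n → ℝ) := Measure.pi fun _ => gaussianReal 0 1
  set L := lovasz ρ (fun i => ∑ j, a i j ^ 2) with hL
  have hL0 : 0 ≤ L := lovasz_nonneg hnonneg _
  set S : (Fin n → ℝ) → ℝ := fun g => ∑ i, Real.exp (normalizedForm (a i) g ^ 2 / 4) with hS
  have hSint : Integrable S μ :=
    integrable_finsetSum _ fun i _ => (exp_sq_normalizedForm_integrable_and_le (a i)).1
  have hSle : ∫ g, S g ∂μ ≤ d * √2 := by
    rw [hS, integral_finsetSum _ fun i _ => (exp_sq_normalizedForm_integrable_and_le (a i)).1]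
    refine (Finset.sum_le_sum fun i _ =>
      (exp_sq_normalizedForm_integrable_and_le (a i)).2).trans_eq ?_
    simp
  have hpoint : ∀ g, lovasz ρ (fun i => (∑ j, a i j * g j) ^ 2)
      ≤ 4 * (Real.log d + S g / d) * L := by
    intro g
    have : Nonempty (Fin d) := ⟨⟨0, hd⟩⟩
    have hSpos : 0 < S g := Finset.sum_pos (fun i _ => Real.exp_pos _) Finset.univ_nonempty
    have hc : 0 < 4 * (Real.log d + S g / d) := by positivity
    rw [hL, ← lovasz_smul ρ _ hc]
    refine lovasz_mono hempty hnonneg hmono fun i => ?_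
    rw [sq_sum_mul_eq, Pi.smul_apply, smul_eq_mul]
    refine mul_le_mul_of_nonneg_right ?_ (Finset.sum_nonneg fun j _ => sq_nonneg _)
    linarith [le_log_add_average_exp hd (fun i => normalizedForm (a i) g ^ 2 / 4) i]
  have hBint : Integrable (fun g => 4 * (Real.log d + S g / d)) μ :=
    ((integrable_const _).add (hSint.div_const _)).const_mul _
  calc ∫ g, lovasz ρ (fun i => (∑ j, a i j * g j) ^ 2) ∂μ
      ≤ ∫ g, 4 * (Real.log d + S g / d) * L ∂μ :=
        integral_mono_of_nonneg (Filter.Eventually.of_forall fun g => lovasz_nonneg hnonneg _)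
          (hBint.mul_const _) (Filter.Eventually.of_forall hpoint)
    _ = 4 * (Real.log d + (∫ g, S g ∂μ) / d) * L := by
        rw [integral_mul_const, integral_const_mul,
          integral_add (integrable_const _) (hSint.div_const _), integral_div]
        simp
    _ ≤ 8 * (1 + Real.log d) * L := by
        have hdiv : (∫ g, S g ∂μ) / d ≤ √2 := by
          rw [div_le_iff₀ hd']
          linarith
        have hsqrt : √2 ≤ (2 : ℝ) := by
          rw [Real.sqrt_le_left (by norm_num)]
          norm_num
        refine mul_le_mul_of_nonneg_right ?_ hL0
        linarith
end

section
/- Let G = (V, E) be a finite simple graph with vertex weights w : V → ℝ>0, and let H be the associated hypergraph with hyperedges e_v = {v} ∪ N(v) of weight w'(e_v) = w_v for each v ∈ V. Then for every nonempty proper subset S ⊊ V: φ^V(S)/(1 + φ^V(S)) ≤ ψ_H(S) ≤ φ^V(S). -/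
open scoped BigOperators

namespace VertexExpansion

variable {V : Type*} [Fintype V]

/-- Inner boundary of `S`: vertices of `S` with a neighbour outside `S`. -/
def Nin (G : SimpleGraph V) (S : Set V) : Set V :=
  {v | v ∈ S ∧ ∃ u, G.Adj v u ∧ u ∉ S}

/-- Outer boundary of `S`: vertices outside `S` with a neighbour in `S`. -/
def Nout (G : SimpleGraph V) (S : Set V) : Set V :=
  {v | v ∉ S ∧ ∃ u, G.Adj v u ∧ u ∈ S}

/-- Total weight of a set of vertices. -/
noncomputable def wsum (w : V → ℝ) (S : Set V) : ℝ := ∑ v, S.indicator w v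

/-- The symmetric vertex expansion of `S`. -/
noncomputable def phiV (G : SimpleGraph V) (w : V → ℝ) (S : Set V) : ℝ :=
  wsum w (Nin G S ∪ Nout G S) / min (wsum w S) (wsum w Sᶜ)

/-- The symmetric vertex expansion of the graph. -/
noncomputable def PhiV (G : SimpleGraph V) (w : V → ℝ) : ℝ :=
  sInf {r | ∃ S : Set V, S.Nonempty ∧ S ≠ Set.univ ∧ r = phiV G w S}

/-- The hyperedge `e_v = {v} ∪ N(v)` of the associated hypergraph. -/
def hedge (G : SimpleGraph V) (v : V) : Set V := insert v (G.neighborSet v)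

/-- The hypergraph conductance `ψ_H(S)` of the associated hypergraph `H`, whose
hyperedges are `e_v = {v} ∪ N(v)` with weight `w v`. -/
noncomputable def psiH (G : SimpleGraph V) (w : V → ℝ) (S : Set V) : ℝ :=
  (∑ v, Set.indicator {v | (hedge G v ∩ S).Nonempty ∧ (hedge G v ∩ Sᶜ).Nonempty} w v) /
    min (∑ v, Set.indicator {v | (hedge G v ∩ S).Nonempty} w v)
        (∑ v, Set.indicator {v | (hedge G v ∩ Sᶜ).Nonempty} w v)

/-- The hypergraph conductance of the associated hypergraph. -/
noncomputable def PsiH (G : SimpleGraph V) (w : V → ℝ) : ℝ :=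
  sInf {r | ∃ S : Set V, S.Nonempty ∧ S ≠ Set.univ ∧ r = psiH G w S}

end VertexExpansion

namespace VertexExpansion

variable {V : Type*}

/-- The hyperedges cut by `S` are those centred at the boundary vertices of `S`. -/
lemma setOf_hedge_cut (G : SimpleGraph V) (S : Set V) :
    {v | (hedge G v ∩ S).Nonempty ∧ (hedge G v ∩ Sᶜ).Nonempty} = Nin G S ∪ Nout G S := by
  ext v
  simp only [hedge, Nin, Nout, Set.Nonempty, Set.mem_inter_iff, Set.mem_insert_iff,
    SimpleGraph.mem_neighborSet, Set.mem_compl_iff, Set.mem_ofPred_eq, Set.mem_union]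
  grind

lemma subset_setOf_hedge_inter (G : SimpleGraph V) (S : Set V) :
    S ⊆ {v | (hedge G v ∩ S).Nonempty} :=
  fun v hv => ⟨v, Set.mem_insert v _, hv⟩

lemma setOf_hedge_inter_subset (G : SimpleGraph V) (S : Set V) :
    {v | (hedge G v ∩ S).Nonempty} ⊆
      S ∪ {v | (hedge G v ∩ S).Nonempty ∧ (hedge G v ∩ Sᶜ).Nonempty} := by
  intro v hv
  by_cases h : v ∈ S
  · exact Or.inl h
  · exact Or.inr ⟨hv, v, Set.mem_insert v _, h⟩

lemma Nin_union_Nout_compl (G : SimpleGraph V) (S : Set V) :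
    Nin G Sᶜ ∪ Nout G Sᶜ = Nin G S ∪ Nout G S := by
  simp only [← setOf_hedge_cut, compl_compl, and_comm]

variable [Fintype V]

lemma wsum_nonneg {w : V → ℝ} (hw : ∀ v, 0 < w v) (S : Set V) : 0 ≤ wsum w S :=
  Finset.sum_nonneg fun v _ => Set.indicator_nonneg (fun u _ => (hw u).le) v

lemma wsum_pos {w : V → ℝ} (hw : ∀ v, 0 < w v) {S : Set V} (hS : S.Nonempty) :
    0 < wsum w S := by
  obtain ⟨x, hx⟩ := hS
  refine Finset.sum_pos' (fun v _ => Set.indicator_nonneg (fun u _ => (hw u).le) v)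
    ⟨x, Finset.mem_univ x, ?_⟩
  rw [Set.indicator_of_mem hx]
  exact hw x

lemma wsum_mono {w : V → ℝ} (hw : ∀ v, 0 < w v) {S T : Set V} (h : S ⊆ T) :
    wsum w S ≤ wsum w T :=
  Finset.sum_le_sum fun v _ => Set.indicator_le_indicator_of_subset h (fun u => (hw u).le) v

lemma wsum_union_le {w : V → ℝ} (hw : ∀ v, 0 < w v) (S T : Set V) :
    wsum w (S ∪ T) ≤ wsum w S + wsum w T := by
  unfold wsum
  rw [← Finset.sum_add_distrib]
  refine Finset.sum_le_sum fun v _ => ?_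
  have := hw v
  by_cases hS : v ∈ S <;> by_cases hT : v ∈ T <;> simp [hS, hT, this.le]

/-- The hyperedges meeting `S` weigh at least as much as `S`, and exceed it by at most the
weight of the boundary of `S`. -/
lemma wsum_hedge_inter_bounds (G : SimpleGraph V) {w : V → ℝ} (hw : ∀ v, 0 < w v)
    (S : Set V) :
    wsum w S ≤ wsum w {v | (hedge G v ∩ S).Nonempty} ∧
      wsum w {v | (hedge G v ∩ S).Nonempty} ≤ wsum w S + wsum w (Nin G S ∪ Nout G S) := by
  refine ⟨wsum_mono hw (subset_setOf_hedge_inter G S), ?_⟩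
  rw [← setOf_hedge_cut]
  exact (wsum_mono hw (setOf_hedge_inter_subset G S)).trans (wsum_union_le hw _ _)

lemma psiH_eq (G : SimpleGraph V) (w : V → ℝ) (S : Set V) :
    psiH G w S = wsum w (Nin G S ∪ Nout G S) /
      min (wsum w {v | (hedge G v ∩ S).Nonempty})
        (wsum w {v | (hedge G v ∩ Sᶜ).Nonempty}) := by
  rw [← setOf_hedge_cut]
  rfl

end VertexExpansion

/-- Relating symmetric vertex expansion in a graph to the conductance of the
associated hypergraph: for every nonempty proper `S ⊆ V`,
`φ^V(S)/(1 + φ^V(S)) ≤ ψ_H(S) ≤ φ^V(S)`. -/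
theorem phiV_psiH_sandwich {V : Type*} [Fintype V] (G : SimpleGraph V)
    (w : V → ℝ) (hw : ∀ v, 0 < w v)
    (S : Set V) (hne : S.Nonempty) (hpr : S ≠ Set.univ) :
    VertexExpansion.phiV G w S / (1 + VertexExpansion.phiV G w S)
        ≤ VertexExpansion.psiH G w S ∧
      VertexExpansion.psiH G w S ≤ VertexExpansion.phiV G w S := by
  obtain ⟨hS, hS'⟩ := VertexExpansion.wsum_hedge_inter_bounds G hw S
  obtain ⟨hT, hT'⟩ := VertexExpansion.wsum_hedge_inter_bounds G hw Sᶜ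
  rw [VertexExpansion.Nin_union_Nout_compl] at hT'
  have hc := VertexExpansion.wsum_nonneg hw
    (VertexExpansion.Nin G S ∪ VertexExpansion.Nout G S)
  have hm : 0 < min (VertexExpansion.wsum w S) (VertexExpansion.wsum w Sᶜ) :=
    lt_min (VertexExpansion.wsum_pos hw hne)
      (VertexExpansion.wsum_pos hw (Set.nonempty_compl.mpr hpr))
  have hle := min_le_min hS hT
  have hle' := (min_le_min hS' hT').trans_eq (min_add_add_right _ _ _)
  rw [VertexExpansion.psiH_eq, VertexExpansion.phiV]
  refine ⟨?_, div_le_div_of_nonneg_left hc hm hle⟩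
  rw [one_add_div hm.ne', div_div_div_cancel_right₀ hm.ne']
  exact div_le_div_of_nonneg_left hc (hm.trans_le hle) hle'
end

section
/- Let H = (V, E) be a finite hypergraph with E nonempty and edge weights w : E → ℝ>0 satisfying w_e ≤ (1/4)·∑_{e'∈E} w_{e'} for every e ∈ E. Then there exists an admissible set A ⊆ V∪E with 0 < vol(A) ≤ volₜₒₜ/2 such that φ̄_H(A) ≤ 4. -/
open scoped BigOperators

namespace HypergraphConductance

variable {V E : Type*} [Fintype V] [Fintype E]

/-- Volume of a set `S ⊆ V ∪ E`: twice the total weight of the hyperedges in `S`. -/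
noncomputable def hvol (w : E → ℝ) (S : Set (V ⊕ E)) : ℝ :=
  ∑ e, Set.indicator {e : E | Sum.inr e ∈ S} (fun e => 2 * w e) e

/-- `symcut(S)`: twice the total weight of hyperedges in `S` that contain a
vertex outside `S`. -/
noncomputable def symcut (edges : E → Set V) (w : E → ℝ) (S : Set (V ⊕ E)) : ℝ :=
  ∑ e, Set.indicator {e : E | Sum.inr e ∈ S ∧ ∃ v ∈ edges e, Sum.inl v ∉ S}
    (fun e => 2 * w e) e

/-- The symmetric conductance `φ̄_H(S)` of `S ⊆ V ∪ E`. -/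
noncomputable def phibar (edges : E → Set V) (w : E → ℝ) (S : Set (V ⊕ E)) : ℝ :=
  (symcut edges w S + symcut edges w Sᶜ) / hvol w S

/-- `S ⊆ V ∪ E` is admissible if every hyperedge in `S` contains a vertex in `S`. -/
def Admissible (edges : E → Set V) (S : Set (V ⊕ E)) : Prop :=
  ∀ e : E, Sum.inr e ∈ S → ∃ v ∈ edges e, Sum.inl v ∈ S

/-- Total volume: twice the total weight of all hyperedges. -/
noncomputable def voltot (w : E → ℝ) : ℝ := ∑ e, 2 * w e

/-- The symmetric conductance `Φ̄_H` of the hypergraph. -/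
noncomputable def PhiBar (edges : E → Set V) (w : E → ℝ) : ℝ :=
  sInf {r | ∃ S : Set (V ⊕ E), Admissible edges S ∧ 0 < hvol w S ∧
    hvol w S ≤ voltot w / 2 ∧ r = phibar edges w S}

/-- The conductance `ψ_H(T)` of a vertex set `T ⊆ V`. -/
noncomputable def psi (edges : E → Set V) (w : E → ℝ) (T : Set V) : ℝ :=
  (∑ e, Set.indicator {e : E | (edges e ∩ T).Nonempty ∧ (edges e ∩ Tᶜ).Nonempty} w e) /
    min (∑ e, Set.indicator {e : E | (edges e ∩ T).Nonempty} w e)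
        (∑ e, Set.indicator {e : E | (edges e ∩ Tᶜ).Nonempty} w e)

/-- The conductance `ψ_H` of the hypergraph. -/
noncomputable def Psi (edges : E → Set V) (w : E → ℝ) : ℝ :=
  sInf {r | ∃ T : Set V, T.Nonempty ∧ T ≠ Set.univ ∧ r = psi edges w T}

end HypergraphConductance

/-- If every weight is at most a quarter of the total, some set of indices carries between
a quarter and a half of the total weight. -/
theorem exists_finset_quarter_le_sum_le_half {E : Type*} [Fintype E] [Nonempty E]
    (w : E → ℝ) (hw : ∀ e, 0 < w e) (hsmall : ∀ e, w e ≤ (1/4) * ∑ e', w e') :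
    ∃ F : Finset E, (1/4) * ∑ e, w e ≤ ∑ e ∈ F, w e ∧ ∑ e ∈ F, w e ≤ (1/2) * ∑ e, w e := by
  classical
  have hpos : 0 < ∑ e, w e := Finset.sum_pos (fun e _ => hw e) Finset.univ_nonempty
  obtain ⟨F, hF, hmax⟩ := Finset.exists_max_image
    (Finset.univ.filter fun F : Finset E => ∑ e ∈ F, w e ≤ (1/2) * ∑ e, w e)
    (fun F => ∑ e ∈ F, w e) ⟨∅, by simpa using hpos.le⟩
  simp only [Finset.mem_filter, Finset.mem_univ, true_and] at hF hmax
  refine ⟨F, ?_, hF⟩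
  by_contra! hlt
  obtain ⟨e, he⟩ : ∃ e, e ∉ F := by
    by_contra! hall
    rw [Finset.eq_univ_iff_forall.mpr hall] at hF
    linarith
  have hins := hmax (insert e F)
  rw [Finset.sum_insert he] at hins
  linarith [hins (by linarith [hsmall e]), hw e]

/-- Under the weight assumption `w_e ≤ (1/4)·∑ w_{e'}`, there is an admissible
set `A ⊆ V ∪ E` with `0 < vol(A) ≤ vol_tot/2` and symmetric conductance at
most `4`. -/
theorem exists_low_conductance_set {V E : Type*} [Fintype V] [Fintype E]
    [Nonempty E]
    (edges : E → Set V) (hedges : ∀ e, (edges e).Nonempty)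
    (w : E → ℝ) (hw : ∀ e, 0 < w e)
    (hsmall : ∀ e, w e ≤ (1/4) * ∑ e', w e') :
    ∃ A : Set (V ⊕ E), HypergraphConductance.Admissible edges A ∧
      0 < HypergraphConductance.hvol w A ∧
      HypergraphConductance.hvol w A ≤ HypergraphConductance.voltot w / 2 ∧
      HypergraphConductance.phibar edges w A ≤ 4 := by
  classical
  obtain ⟨F, hlow, hhigh⟩ := exists_finset_quarter_le_sum_le_half w hw hsmall
  have hpos : 0 < ∑ e, w e := Finset.sum_pos (fun e _ => hw e) Finset.univ_nonempty
  set A : Set (V ⊕ E) := {x | ∀ e, x = Sum.inr e → e ∈ F} with hA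
  have hinl : ∀ v, Sum.inl v ∈ A := by simp [hA]
  have hvol_eq : HypergraphConductance.hvol w A = 2 * ∑ e ∈ F, w e := by
    simp [HypergraphConductance.hvol, hA, Set.indicator_apply, Finset.sum_ite_mem,
      Finset.mul_sum]
  have hvoltot : HypergraphConductance.voltot w = 2 * ∑ e, w e := by
    simp [HypergraphConductance.voltot, Finset.mul_sum]
  have hcut : HypergraphConductance.symcut edges w A = 0 := by
    simp [HypergraphConductance.symcut, hinl]
  have hcut_compl : HypergraphConductance.symcut edges w Aᶜ ≤ 2 * ∑ e, w e := by
    rw [HypergraphConductance.symcut, Finset.mul_sum]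
    exact Finset.sum_le_sum fun e _ =>
      Set.indicator_le_self' (fun e _ => by linarith [hw e]) e
  refine ⟨A, fun e _ => ?_, by linarith, by linarith, ?_⟩
  · obtain ⟨v, hv⟩ := hedges e
    exact ⟨v, hv, hinl v⟩
  · rw [HypergraphConductance.phibar, div_le_iff₀ (by linarith)]
    linarith
end
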